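/- Let I be a square-free monomial ideal of S generated in degree k ≥ 1 and let u_1,…,u_t ∈ G(I) form an induced matching with t ≥ 2. Then for every integer s ≥ 2 and all indices i ≠ j: the monomials u_i^s and u_i^{s-1} u_j are distinct elements of G(I^s), lcm(u_i^s, u_i^{s-1} u_j) = u_i^s u_j, and every element of G(I^s) dividing u_i^s u_j is equal to u_i^s or to u_i^{s-1} u_j. -/

import Mathlib

open MvPolynomial

/-- The monomial ideal of `MvPolynomial (Fin n) K` generated by the monomials
whose exponent vectors lie in `A`. -/
noncomputable def mIdeal (K : Type) [Field K] {n : ℕ} (A : Set (Fin n →₀ ℕ)) :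
    Ideal (MvPolynomial (Fin n) K) :=
  Ideal.span ((fun a => monomial a (1 : K)) '' A)

/-- `G` is the (unique) minimal set of monomial generators of the monomial ideal `I`:
the monomials with exponent vectors in `G` generate `I`, and `G` is an antichain with
respect to divisibility of monomials (i.e. the pointwise order on exponent vectors). -/
def IsMinGen (K : Type) [Field K] {n : ℕ} (G : Finset (Fin n →₀ ℕ))
    (I : Ideal (MvPolynomial (Fin n) K)) : Prop :=
  I = mIdeal K (↑G : Set (Fin n →₀ ℕ)) ∧ ∀ a ∈ G, ∀ b ∈ G, a ≤ b → a = b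

/-- The set of all sums of `m` elements of `A`. -/
def iteratedSumset {M : Type*} [AddMonoid M] (A : Set M) : ℕ → Set M
  | 0 => {0}
  | m + 1 => Set.image2 (· + ·) (iteratedSumset A m) A

theorem nsmul_mem_iteratedSumset {M : Type*} [AddMonoid M] {A : Set M} {a : M} (ha : a ∈ A)
    (m : ℕ) : m • a ∈ iteratedSumset A m := by
  induction m with
  | zero => simp [iteratedSumset]
  | succ m ih => exact ⟨m • a, ih, a, ha, (succ_nsmul a m).symm⟩

theorem degree_of_mem_iteratedSumset {n k : ℕ} {A : Set (Fin n →₀ ℕ)}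
    (hA : ∀ a ∈ A, a.degree = k) {m : ℕ} {w : Fin n →₀ ℕ} (hw : w ∈ iteratedSumset A m) :
    w.degree = m * k := by
  induction m generalizing w with
  | zero => simp_all [iteratedSumset]
  | succ m ih =>
    obtain ⟨p, hp, a, ha, rfl⟩ := hw
    simp only [map_add, ih hp, hA a ha]
    ring

theorem Finsupp.eq_of_le_of_degree_eq {n : ℕ} {a b : Fin n →₀ ℕ} (h : a ≤ b)
    (hd : a.degree = b.degree) : a = b := by
  obtain ⟨c, rfl⟩ := exists_add_of_le h
  have hc : c.degree = 0 := by
    rw [map_add] at hd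
    omega
  rw [(Finsupp.degree_eq_zero_iff c).1 hc, add_zero]

theorem mIdeal_mul (K : Type) [Field K] {n : ℕ} (A B : Set (Fin n →₀ ℕ)) :
    mIdeal K A * mIdeal K B = mIdeal K (Set.image2 (· + ·) A B) := by
  unfold mIdeal
  rw [Ideal.span_mul_span', ← Set.image2_mul, Set.image2_image_left, Set.image2_image_right,
    Set.image_image2]
  simp [monomial_mul]

theorem mIdeal_pow (K : Type) [Field K] {n : ℕ} (A : Set (Fin n →₀ ℕ)) (m : ℕ) :
    mIdeal K A ^ m = mIdeal K (iteratedSumset A m) := by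
  induction m with
  | zero => simp [iteratedSumset, mIdeal, Ideal.one_eq_top]
  | succ m ih => rw [pow_succ, ih, mIdeal_mul, iteratedSumset]

theorem exists_le_of_mIdeal_le {K : Type} [Field K] {n : ℕ} {A B : Set (Fin n →₀ ℕ)}
    (h : mIdeal K A ≤ mIdeal K B) {a : Fin n →₀ ℕ} (ha : a ∈ A) : ∃ b ∈ B, b ≤ a := by
  have hm : monomial a (1 : K) ∈ mIdeal K B := h (Ideal.subset_span ⟨a, ha, rfl⟩)
  exact mem_ideal_span_monomial_image.1 hm a (by simp)

/-- The minimal generators of a power of an equigenerated monomial ideal are exactly the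
products of its generators. -/
theorem IsMinGen.mem_pow_iff {K : Type} [Field K] {n k s : ℕ}
    {I : Ideal (MvPolynomial (Fin n) K)} {G Gs : Finset (Fin n →₀ ℕ)} (hG : IsMinGen K G I)
    (hdeg : ∀ a ∈ G, a.degree = k) (hGs : IsMinGen K Gs (I ^ s)) (w : Fin n →₀ ℕ) :
    w ∈ Gs ↔ w ∈ iteratedSumset (G : Set (Fin n →₀ ℕ)) s := by
  have h : mIdeal K (iteratedSumset (G : Set (Fin n →₀ ℕ)) s) = mIdeal K (Gs : Set _) := by
    rw [← mIdeal_pow, ← hG.1, hGs.1]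
  constructor
  · intro hw
    obtain ⟨p, hp, hpw⟩ := exists_le_of_mIdeal_le h.ge hw
    obtain ⟨v, hv, hvp⟩ := exists_le_of_mIdeal_le h.le hp
    have hvw := hGs.2 v hv w hw (hvp.trans hpw)
    rwa [le_antisymm (hvw ▸ hvp) hpw]
  · intro hw
    obtain ⟨v, hv, hvw⟩ := exists_le_of_mIdeal_le h.le hw
    obtain ⟨p, hp, hpv⟩ := exists_le_of_mIdeal_le h.ge hv
    have hpw := Finsupp.eq_of_le_of_degree_eq (hpv.trans hvw)
      ((degree_of_mem_iteratedSumset hdeg hp).trans (degree_of_mem_iteratedSumset hdeg hw).symm)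
    rwa [le_antisymm (hpw ▸ hpv) hvw]

theorem eq_nsmul_add_nsmul_of_mem_iteratedSumset {M : Type*} [AddCommMonoid M] [PartialOrder M]
    [CanonicallyOrderedAdd M] {A : Set M} {a b c : M}
    (h : ∀ v ∈ A, v ≤ c → v = a ∨ v = b) {m : ℕ} {w : M} (hw : w ∈ iteratedSumset A m)
    (hwc : w ≤ c) : ∃ p q : ℕ, p + q = m ∧ w = p • a + q • b := by
  induction m generalizing w with
  | zero => exact ⟨0, 0, rfl, by simpa [iteratedSumset] using hw⟩
  | succ m ih =>
    obtain ⟨x, hx, v, hv, rfl⟩ := hw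
    obtain ⟨p, q, hpq, rfl⟩ := ih hx (le_self_add.trans hwc)
    rcases h v hv (le_add_self.trans hwc) with rfl | rfl
    · exact ⟨p + 1, q, by omega, by simp only [succ_nsmul]; abel⟩
    · exact ⟨p, q + 1, by omega, by simp only [succ_nsmul]; abel⟩

/-- Let `I` be a square-free monomial ideal generated in degree `k ≥ 1`, with minimal
monomial generators `G`, and let `u_1,…,u_t ∈ G(I)` (`t ≥ 2`) form an induced matching.
Then for every `s ≥ 2` and all `i ≠ j`: the monomials `u_i^s` and `u_i^{s-1} u_j` are
distinct elements of `G(I^s)`, `lcm(u_i^s, u_i^{s-1} u_j) = u_i^s u_j`, and every element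
of `G(I^s)` dividing `u_i^s u_j` equals `u_i^s` or `u_i^{s-1} u_j`.  (On exponent
vectors, powers are scalar multiples, products are sums, divisibility is `≤`,
`gcd` is `⊓` and `lcm` is `⊔`.) -/
theorem induced_matching_generators_of_power_divisors
    {K : Type} [Field K] {n : ℕ}
    (I : Ideal (MvPolynomial (Fin n) K)) (G : Finset (Fin n →₀ ℕ)) (hG : IsMinGen K G I)
    (k : ℕ) (hk : 1 ≤ k)
    (hsf : ∀ a ∈ G, ∀ i, a i ≤ 1)
    (hdeg : ∀ a ∈ G, (a.sum fun _ e => e) = k)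
    (t : ℕ) (ht : 2 ≤ t) (u : Fin t → (Fin n →₀ ℕ)) (humem : ∀ i, u i ∈ G)
    (hmatch₁ : ∀ i j, i ≠ j → u i ⊓ u j = 0)
    (hmatch₂ : ∀ w ∈ G, w ≤ ∑ i, u i → ∃ i, w = u i)
    (s : ℕ) (hs : 2 ≤ s)
    (Gs : Finset (Fin n →₀ ℕ)) (hGs : IsMinGen K Gs (I ^ s))
    (i j : Fin t) (hij : i ≠ j) :
    s • u i ∈ Gs ∧
    (s - 1) • u i + u j ∈ Gs ∧
    s • u i ≠ (s - 1) • u i + u j ∧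
    (s • u i) ⊔ ((s - 1) • u i + u j) = s • u i + u j ∧
    ∀ w ∈ Gs, w ≤ s • u i + u j → w = s • u i ∨ w = (s - 1) • u i + u j := by
  have hdeg' : ∀ a ∈ G, a.degree = k := hdeg
  have hdisj : ∀ i j, i ≠ j → ∀ x, u i x = 0 ∨ u j x = 0 := by
    intro i j hij x
    have := DFunLike.congr_fun (hmatch₁ i j hij) x
    simp only [Finsupp.inf_apply, Finsupp.coe_zero, Pi.zero_apply] at this
    omega
  have hne : ∀ i, ∃ x, u i x ≠ 0 := by
    intro i
    by_contra! h
    have h0 : u i = 0 := Finsupp.ext h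
    have := hdeg' _ (humem i)
    rw [h0, map_zero] at this
    omega
  obtain ⟨r, rfl⟩ : ∃ r, s = r + 1 := ⟨s - 1, by omega⟩
  simp only [Nat.add_sub_cancel, hG.mem_pow_iff hdeg' hGs]
  have hmem : ∀ v ∈ (G : Set (Fin n →₀ ℕ)), v ≤ (r + 1) • u i + u j → v = u i ∨ v = u j := by
    intro v hv hle
    have hvx : ∀ x, v x ≤ u i x + u j x := by
      intro x
      have h1 := hle x
      have h2 := hsf v hv x
      by_cases h0 : u i x = 0
      · simpa [h0] using h1
      · omega
    have hsum : u i + u j ≤ ∑ l, u l := by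
      rw [← Finset.sum_pair hij]
      exact Finset.sum_le_sum_of_subset (Finset.subset_univ _)
    obtain ⟨l, rfl⟩ := hmatch₂ v hv (le_trans (fun x => hvx x) hsum)
    by_contra! h
    obtain ⟨x, hx⟩ := hne l
    have h1 := hdisj l i (fun e => h.1 (e ▸ rfl)) x
    have h2 := hdisj l j (fun e => h.2 (e ▸ rfl)) x
    have := hvx x
    omega
  refine ⟨nsmul_mem_iteratedSumset (humem i) _,
    ⟨_, nsmul_mem_iteratedSumset (humem i) r, _, humem j, rfl⟩, ?_, ?_, ?_⟩
  · intro h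
    rw [succ_nsmul] at h
    obtain ⟨x, hx⟩ := hne i
    have h1 := hdisj i j hij x
    have := DFunLike.congr_fun (add_left_cancel h) x
    omega
  · ext x
    simp only [Finsupp.sup_apply, Finsupp.add_apply, Finsupp.smul_apply, smul_eq_mul]
    rcases hdisj i j hij x with h | h <;> simp [h, Nat.mul_le_mul_right]
  · intro w hw hle
    obtain ⟨p, q, hpq, rfl⟩ := eq_nsmul_add_nsmul_of_mem_iteratedSumset hmem hw hle
    obtain ⟨x, hx⟩ := hne j
    have h0 : u i x = 0 := (hdisj i j hij x).resolve_right hx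
    have hq : q * u j x ≤ 1 * u j x := by simpa [h0] using hle x
    have hq1 : q ≤ 1 := Nat.le_of_mul_le_mul_right hq (Nat.pos_of_ne_zero hx)
    obtain rfl | rfl : q = 0 ∨ q = 1 := by omega
    · left
      simp [← hpq]
    · right
      obtain rfl : p = r := by omega
      simp
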